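/- Let p be an odd prime, m ≥ 1, and D the dihedral group of order 2p^m. Let F_q be a finite field with gcd(2p^m, q) = 1 and q generating the unit group of Z/p^m. Then the left ideal I = (F_q D)(e₁₁ − e₁₂) (with e = e_j, 1 ≤ j ≤ m, and e₁₁, e₁₂ as defined) has F_q-dimension φ(p^j). -/

import Mathlib

open scoped Classical

/-- `hat F S` is the element `Ŝ = (1/|S|) ∑_{s ∈ S} s` of the group algebra `F G`. -/
noncomputable def hat (F : Type*) [Field F] {G : Type*} [Group G] [Fintype G]
    (S : Subgroup G) : MonoidAlgebra F G :=
  (Nat.card S : F)⁻¹ • ∑ g : G, if g ∈ S then MonoidAlgebra.of F G g else 0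

section Hat

variable {F : Type*} [Field F] {G : Type*} [Group G] [Fintype G]

theorem of_mul_hat {S : Subgroup G} {s : G} (hs : s ∈ S) :
    MonoidAlgebra.of F G s * hat F S = hat F S := by
  rw [hat, mul_smul_comm, Finset.mul_sum]
  congr 1
  refine Fintype.sum_equiv (Equiv.mulLeft s) _ _ fun g => ?_
  simp only [Equiv.coe_mulLeft, S.mul_mem_cancel_left hs]
  split_ifs <;> simp

theorem hat_mul_of {S : Subgroup G} {s : G} (hs : s ∈ S) :
    hat F S * MonoidAlgebra.of F G s = hat F S := by
  rw [hat, smul_mul_assoc, Finset.sum_mul]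
  congr 1
  refine Fintype.sum_equiv (Equiv.mulRight s) _ _ fun g => ?_
  simp only [Equiv.coe_mulRight, S.mul_mem_cancel_right hs]
  split_ifs <;> simp

theorem hat_mul_eq_self {S : Subgroup G} (hS : (Nat.card S : F) ≠ 0) {x : MonoidAlgebra F G}
    (hx : ∀ s ∈ S, MonoidAlgebra.of F G s * x = x) : hat F S * x = x := by
  have h : ∀ g : G, (if g ∈ S then MonoidAlgebra.of F G g else 0) * x =
      if g ∈ S then x else 0 := fun g => by
    split_ifs with hg
    · exact hx g hg
    · exact zero_mul x
  rw [hat, smul_mul_assoc, Finset.sum_mul, Finset.sum_congr rfl fun g _ => h g,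
    ← Finset.sum_filter, Finset.sum_const, ← Fintype.card_subtype, ← Nat.card_eq_fintype_card,
    ← Nat.cast_smul_eq_nsmul F]
  exact inv_smul_smul₀ hS x

theorem mul_hat_eq_self {S : Subgroup G} (hS : (Nat.card S : F) ≠ 0) {x : MonoidAlgebra F G}
    (hx : ∀ s ∈ S, x * MonoidAlgebra.of F G s = x) : x * hat F S = x := by
  have h : ∀ g : G, x * (if g ∈ S then MonoidAlgebra.of F G g else 0) =
      if g ∈ S then x else 0 := fun g => by
    split_ifs with hg
    · exact hx g hg
    · exact mul_zero x
  rw [hat, mul_smul_comm, Finset.mul_sum, Finset.sum_congr rfl fun g _ => h g,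
    ← Finset.sum_filter, Finset.sum_const, ← Fintype.card_subtype, ← Nat.card_eq_fintype_card,
    ← Nat.cast_smul_eq_nsmul F]
  exact inv_smul_smul₀ hS x

theorem hat_mul_hat_of_le {S T : Subgroup G} (hS : (Nat.card S : F) ≠ 0) (h : S ≤ T) :
    hat F S * hat F T = hat F T :=
  hat_mul_eq_self hS fun _ hs => of_mul_hat (h hs)

theorem hat_mul_hat_of_ge {S T : Subgroup G} (hT : (Nat.card T : F) ≠ 0) (h : T ≤ S) :
    hat F S * hat F T = hat F S :=
  mul_hat_eq_self hT fun _ ht => hat_mul_of (h ht)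

theorem commute_hat (S : Subgroup G) [hS : S.Normal] (x : MonoidAlgebra F G) :
    Commute x (hat F S) := by
  induction x using MonoidAlgebra.induction_on with
  | of t =>
    rw [Commute, SemiconjBy, hat, mul_smul_comm, smul_mul_assoc, Finset.mul_sum, Finset.sum_mul]
    congr 1
    refine Fintype.sum_equiv (MulAut.conj t).toEquiv _ _ fun g => ?_
    have hg : t * g * t⁻¹ ∈ S ↔ g ∈ S :=
      ⟨fun h => by simpa [mul_assoc] using hS.conj_mem _ h t⁻¹, fun h => hS.conj_mem g h t⟩
    simp only [MulEquiv.toEquiv_eq_coe, MulEquiv.coe_toEquiv, MulAut.conj_apply, hg]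
    split_ifs
    · simp only [← map_mul, inv_mul_cancel_right]
    · rw [mul_zero, zero_mul]
  | add x y hx hy => exact hx.add_left hy
  | smul r x hx => exact hx.smul_left r

theorem hat_sup {S T : Subgroup G} [S.Normal] (hS : (Nat.card S : F) ≠ 0)
    (hT : (Nat.card T : F) ≠ 0) (hST : (Nat.card (S ⊔ T : Subgroup G) : F) ≠ 0) :
    hat F (S ⊔ T) = hat F S * hat F T := by
  have hfix : ∀ s ∈ S ⊔ T, hat F S * hat F T * MonoidAlgebra.of F G s = hat F S * hat F T := by
    intro s hs
    rw [Subgroup.sup_eq_closure] at hs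
    induction hs using Subgroup.closure_induction with
    | mem x hx =>
      rcases hx with hx | hx
      · rw [← (commute_hat S (hat F T)).eq, mul_assoc, hat_mul_of hx]
      · rw [mul_assoc, hat_mul_of hx]
    | one => rw [map_one, mul_one]
    | mul x y _ _ hx hy => rw [map_mul, ← mul_assoc, hx, hy]
    | inv x _ hx =>
      conv_lhs => rw [← hx]
      rw [mul_assoc, ← map_mul, mul_inv_cancel, map_one, mul_one]
  rw [← mul_hat_eq_self hST hfix, mul_assoc, hat_mul_hat_of_le hT le_sup_right,
    hat_mul_hat_of_le hS le_sup_left]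

theorem hat_zpowers_of_orderOf_eq_two {g : G} (hg : orderOf g = 2) :
    hat F (Subgroup.zpowers g) = (2 : F)⁻¹ • (1 + MonoidAlgebra.of F G g) := by
  have hmem : ∀ x, x ∈ Subgroup.zpowers g ↔ x ∈ ({1, g} : Finset G) := fun x => by
    rw [← mem_powers_iff_mem_zpowers, mem_powers_iff_mem_range_orderOf, hg]
    simp [Finset.range_add_one, eq_comm, or_comm]
  have h1 : (1 : G) ≠ g := by
    rintro rfl
    simp at hg
  rw [hat, Nat.card_zpowers, hg]
  simp only [hmem]
  rw [Finset.sum_ite_mem, Finset.univ_inter, Finset.sum_pair h1, map_one, Nat.cast_ofNat]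

/-- The left ideal `(F G) Ŝ` is the space of functions on `G` constant on left cosets of `S`. -/
theorem finrank_range_mulRight_hat {S : Subgroup G} (hS : (Nat.card S : F) ≠ 0) :
    Module.finrank F (LinearMap.range (LinearMap.mulRight F (hat F S))) = S.index := by
  let L : (G ⧸ S → F) →ₗ[F] MonoidAlgebra F G :=
    (Fintype.linearCombination F (MonoidAlgebra.of F G)).comp
      (LinearMap.funLeft F F QuotientGroup.mk)
  have hL : ∀ f, L f = ∑ g : G, f g • MonoidAlgebra.of F G g := fun f => by
    simp [L, Fintype.linearCombination_apply]
  have hcoeff : ∀ f (g : G), (L f).coeff g = f g := fun f g => by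
    rw [hL, MonoidAlgebra.coeff_sum, Finsupp.finsetSum_apply]
    simp [Finsupp.single_apply]
  have hinj : Function.Injective L := fun f f' h => by
    funext q
    obtain ⟨g, rfl⟩ := QuotientGroup.mk_surjective q
    rw [← hcoeff f, h, hcoeff]
  have hmulcoeff : ∀ (x : MonoidAlgebra F G) (g s : G),
      (x * MonoidAlgebra.of F G s).coeff (g * s) = x.coeff g := fun x g s => by
    simp
  have hrange : LinearMap.range (LinearMap.mulRight F (hat F S)) = LinearMap.range L := by
    ext x
    constructor
    · rintro ⟨y, rfl⟩
      refine ⟨fun q => (y * hat F S).coeff q.out, ?_⟩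
      ext g
      rw [hcoeff]
      obtain ⟨s, hs⟩ := QuotientGroup.mk_out_eq_mul S g
      rw [hs, LinearMap.mulRight_apply, ← hmulcoeff (y * hat F S) g s, mul_assoc,
        hat_mul_of s.2]
    · rintro ⟨f, rfl⟩
      refine ⟨L f, mul_hat_eq_self hS fun s hs => ?_⟩
      ext g
      have hg := hmulcoeff (L f) (g * s⁻¹) s
      rw [inv_mul_cancel_right, hcoeff] at hg
      rw [hg, hcoeff]
      congr 1
      exact QuotientGroup.eq.2 (by simpa using hs)
  rw [hrange, LinearMap.finrank_range_of_inj hinj, Module.finrank_fintype_fun_eq_card,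
    Subgroup.index, Nat.card_eq_fintype_card]

end Hat

section Algebra

variable {K A : Type*} [Field K] [Ring A] [Algebra K A]

theorem restrictScalars_span_singleton_eq_range_mulRight (x : A) :
    Submodule.restrictScalars K (Ideal.span {x}) = LinearMap.range (LinearMap.mulRight K x) := by
  ext y
  simp [Ideal.mem_span_singleton']

theorem finrank_range_mulRight_mul_isUnit (x : A) {w : A} (hw : IsUnit w) :
    Module.finrank K (LinearMap.range (LinearMap.mulRight K (x * w))) =
      Module.finrank K (LinearMap.range (LinearMap.mulRight K x)) := by
  rw [LinearMap.mulRight_mul, LinearMap.range_comp]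
  exact (Submodule.equivMapOfInjective _ hw.mul_left_injective _).finrank_eq.symm

theorem finrank_range_mulRight_sub [FiniteDimensional K A] {s t : A} (hs : IsIdempotentElem s)
    (ht : IsIdempotentElem t) (hst : s * t = t) (hts : t * s = t) :
    Module.finrank K (LinearMap.range (LinearMap.mulRight K (s - t))) =
      Module.finrank K (LinearMap.range (LinearMap.mulRight K s)) -
        Module.finrank K (LinearMap.range (LinearMap.mulRight K t)) := by
  have hsup : LinearMap.range (LinearMap.mulRight K (s - t)) ⊔
      LinearMap.range (LinearMap.mulRight K t) = LinearMap.range (LinearMap.mulRight K s) := by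
    apply le_antisymm
    · refine sup_le ?_ ?_
      · rintro _ ⟨y, rfl⟩
        exact ⟨y * (s - t), by simp [mul_assoc, sub_mul, hs.eq, hts]⟩
      · rintro _ ⟨y, rfl⟩
        exact ⟨y * t, by simp [mul_assoc, hts]⟩
    · rintro _ ⟨y, rfl⟩
      exact Submodule.mem_sup.2 ⟨_, ⟨y, rfl⟩, _, ⟨y, rfl⟩, by simp [mul_sub]⟩
  have hinf : LinearMap.range (LinearMap.mulRight K (s - t)) ⊓
      LinearMap.range (LinearMap.mulRight K t) = ⊥ := by
    rw [eq_bot_iff]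
    rintro x ⟨⟨y, rfl⟩, ⟨z, hz⟩⟩
    simp only [LinearMap.mulRight_apply] at hz ⊢
    have h : y * (s - t) * t = z * t * t := by rw [hz]
    rw [mul_assoc, sub_mul, hst, ht.eq, sub_self, mul_zero, mul_assoc, ht.eq, hz] at h
    exact h.symm
  have h := Submodule.finrank_sup_add_finrank_inf_eq
    (LinearMap.range (LinearMap.mulRight K (s - t))) (LinearMap.range (LinearMap.mulRight K t))
  rw [hsup, hinf, finrank_bot] at h
  omega

end Algebra

section Dihedral

instance DihedralGroup.normal_zpowers_r_one_pow (n k : ℕ) :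
    (Subgroup.zpowers ((DihedralGroup.r 1 : DihedralGroup n) ^ k)).Normal := by
  refine ⟨fun x hx g => ?_⟩
  obtain ⟨i, rfl⟩ := Subgroup.mem_zpowers_iff.1 hx
  rw [DihedralGroup.r_one_pow, DihedralGroup.r_zpow]
  cases g with
  | r c => exact Subgroup.mem_zpowers_iff.2 ⟨i, by simp⟩
  | sr c => exact Subgroup.mem_zpowers_iff.2 ⟨-i, by simp⟩

theorem DihedralGroup.index_zpowers_r_one_pow_sup {n k : ℕ} (hn : Odd n) (hk : k ∣ n) :
    (Subgroup.zpowers ((DihedralGroup.r 1 : DihedralGroup n) ^ k) ⊔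
      Subgroup.zpowers (DihedralGroup.sr 0)).index = k := by
  obtain ⟨l, rfl⟩ := hk
  have hkl : 0 < k * l := hn.pos
  have hl : Odd l := (Nat.odd_mul.1 hn).2
  have hH : Nat.card (Subgroup.zpowers ((DihedralGroup.r 1 : DihedralGroup (k * l)) ^ k)) = l := by
    rw [Nat.card_zpowers, orderOf_pow' _ (Nat.pos_of_mul_pos_right hkl).ne',
      DihedralGroup.orderOf_r_one, Nat.gcd_eq_right (dvd_mul_right k l),
      Nat.mul_div_cancel_left l (Nat.pos_of_mul_pos_right hkl)]
  have hL : Nat.card (Subgroup.zpowers (DihedralGroup.sr 0 : DihedralGroup (k * l))) = 2 := by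
    rw [Nat.card_zpowers, DihedralGroup.orderOf_sr]
  have hbot : Subgroup.zpowers ((DihedralGroup.r 1 : DihedralGroup (k * l)) ^ k) ⊓
      Subgroup.zpowers (DihedralGroup.sr 0) = ⊥ :=
    (Subgroup.disjoint_of_coprime_natCard (by rw [hH, hL]; exact hl.coprime_two_right)).eq_bot
  have h1 := Subgroup.relIndex_mul_index (le_sup_left :
    Subgroup.zpowers ((DihedralGroup.r 1 : DihedralGroup (k * l)) ^ k) ≤
      _ ⊔ Subgroup.zpowers (DihedralGroup.sr 0))
  rw [Subgroup.relIndex_sup_left, ← Subgroup.inf_relIndex_right, hbot,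
    Subgroup.relIndex_bot_left, hL] at h1
  have h2 := Subgroup.card_mul_index
    (Subgroup.zpowers ((DihedralGroup.r 1 : DihedralGroup (k * l)) ^ k))
  rw [hH, DihedralGroup.nat_card, ← h1] at h2
  refine Nat.eq_of_mul_eq_mul_left (Nat.mul_pos two_pos hl.pos) ?_
  linarith

end Dihedral

theorem natCard_subgroup_cast_ne_zero {F G : Type*} [Field F] [Fintype F] [Group G]
    (hG : (Nat.card G).Coprime (Fintype.card F)) (S : Subgroup G) : (Nat.card S : F) ≠ 0 := by
  intro h
  have hS : IsCoprime ((Nat.card S : ℕ) : F) ((Fintype.card F : ℕ) : F) :=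
    (Nat.Coprime.coprime_dvd_left S.card_subgroup_dvd_card hG).cast
  rw [h, FiniteField.cast_card_eq_zero] at hS
  exact not_isCoprime_zero_zero hS

theorem stmt18 {F : Type*} [Field F] [Fintype F] (p m j : ℕ) (hp : p.Prime)
    (hodd : Odd p) (hm : 1 ≤ m) (hj : 1 ≤ j) (hjm : j ≤ m)
    (hq : Nat.Coprime (2 * p ^ m) (Fintype.card F)) [NeZero (p ^ m)]
    (hcop : Nat.Coprime (Fintype.card F) (p ^ m))
    -- `q` generates the unit group of `ℤ/pᵐ`
    (hgen : orderOf (ZMod.unitOfCoprime (Fintype.card F) hcop) =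
      (p ^ m).totient) :
    let D := DihedralGroup (p ^ m)
    let a : MonoidAlgebra F D := MonoidAlgebra.of F D (DihedralGroup.r 1)
    let b : MonoidAlgebra F D := MonoidAlgebra.of F D (DihedralGroup.sr 0)
    let e : MonoidAlgebra F D :=
      hat F (Subgroup.zpowers (DihedralGroup.r 1 ^ p ^ j)) -
        hat F (Subgroup.zpowers (DihedralGroup.r 1 ^ p ^ (j - 1)))
    let f : MonoidAlgebra F D := ((2 : F)⁻¹ • (1 + b)) * e -
      ((2 : F)⁻¹ • (1 + b)) * a * ((2 : F)⁻¹ • (1 - b)) * e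
    Module.finrank F (Submodule.restrictScalars F (Ideal.span {f})) =
      (p ^ j).totient := by
  intro D a b e f
  have hcard : ∀ S : Subgroup D, (Nat.card S : F) ≠ 0 :=
    natCard_subgroup_cast_ne_zero (by rwa [DihedralGroup.nat_card])
  set H : ℕ → Subgroup D := fun i => Subgroup.zpowers (DihedralGroup.r 1 ^ p ^ i) with hH
  set L : Subgroup D := Subgroup.zpowers (DihedralGroup.sr 0) with hL
  have hu : (2 : F)⁻¹ • (1 + b) = hat F L :=
    (hat_zpowers_of_orderOf_eq_two (DihedralGroup.orderOf_sr 0)).symm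
  set v : MonoidAlgebra F D := (2 : F)⁻¹ • (1 - b) with hv
  have huv : v * hat F L = 0 := by
    rw [hv, smul_mul_assoc, sub_mul, one_mul, of_mul_hat (Subgroup.mem_zpowers _), sub_self,
      smul_zero]
  have hmono : H j ≤ H (j - 1) := by
    refine Subgroup.zpowers_le.2 (Subgroup.mem_zpowers_iff.2 ⟨p, ?_⟩)
    rw [zpow_natCast, ← pow_mul, ← pow_succ, Nat.sub_add_cancel hj]
  have he : ∀ x, Commute x e := fun x => (commute_hat (H j) x).sub_right (commute_hat (H (j - 1)) x)
  have hLL : hat F L * hat F L = hat F L := hat_mul_hat_of_le (hcard L) le_rfl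
  have hue : hat F L * e = hat F (H j ⊔ L) - hat F (H (j - 1) ⊔ L) := by
    rw [(he _).eq, hat_sup (hcard _) (hcard _) (hcard _), hat_sup (hcard _) (hcard _) (hcard _),
      ← sub_mul]
  have hnil : hat F L * a * v * (hat F L * a * v) = 0 := by
    rw [← mul_assoc, ← mul_assoc, mul_assoc (hat F L * a) v, huv, mul_zero, zero_mul, zero_mul]
  have hf : f = hat F L * e * (1 - hat F L * a * v) := by
    have h : hat F L * e * (hat F L * a * v) = hat F L * a * v * e := by
      rw [mul_assoc, ← (he _).eq, ← mul_assoc, ← mul_assoc, ← mul_assoc, hLL]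
    rw [mul_sub, mul_one, h, ← hu]
  have hw : IsUnit (1 - hat F L * a * v) :=
    IsNilpotent.isUnit_one_sub ⟨2, by rw [pow_two, hnil]⟩
  have hle : H j ⊔ L ≤ H (j - 1) ⊔ L := sup_le_sup_right hmono L
  rw [restrictScalars_span_singleton_eq_range_mulRight, hf, finrank_range_mulRight_mul_isUnit _ hw,
    hue, finrank_range_mulRight_sub (hat_mul_hat_of_le (hcard _) le_rfl)
      (hat_mul_hat_of_le (hcard _) le_rfl) (hat_mul_hat_of_le (hcard _) hle)
      (hat_mul_hat_of_ge (hcard _) hle),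
    finrank_range_mulRight_hat (hcard _), finrank_range_mulRight_hat (hcard _),
    DihedralGroup.index_zpowers_r_one_pow_sup hodd.pow (pow_dvd_pow p hjm),
    DihedralGroup.index_zpowers_r_one_pow_sup hodd.pow (pow_dvd_pow p (by omega)),
    Nat.totient_prime_pow hp hj, Nat.mul_sub_one, ← pow_succ, Nat.sub_add_cancel hj]
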